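/- Let K be a symmetric positive definite matrix in ℝ^{(n+m)×(n+m)} satisfying the discounted algebraic Riccati equation K = αK − α²·K B (α BᵀKB + R)^{-1} BᵀK + Q, where Q is a symmetric M-matrix. Then every off-diagonal entry of K is nonpositive; consequently K, being symmetric positive definite with nonpositive off-diagonal entries, is a nonsingular M-matrix. -/

import Mathlib

open Matrix

/-- The block matrix with `I_n` on top and the `m × n` zero matrix below. -/
def Bmat (n m : ℕ) : Matrix (Fin n ⊕ Fin m) (Fin n) ℝ :=
  Matrix.of fun p j =>
    match p with
    | Sum.inl i => if i = j then (1 : ℝ) else 0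
    | Sum.inr _ => 0

/-- `ρ(D) ≤ s` : every complex eigenvalue of `D` has absolute value at most `s`. -/
def specRadLE {ι : Type*} [Fintype ι] [DecidableEq ι]
    (D : Matrix ι ι ℝ) (s : ℝ) : Prop :=
  ∀ μ ∈ spectrum ℂ (D.map (algebraMap ℝ ℂ)), ‖μ‖ ≤ s

/-- `ρ(D) < s` : every complex eigenvalue of `D` has absolute value less than `s`. -/
def specRadLT {ι : Type*} [Fintype ι] [DecidableEq ι]
    (D : Matrix ι ι ℝ) (s : ℝ) : Prop :=
  ∀ μ ∈ spectrum ℂ (D.map (algebraMap ℝ ℂ)), ‖μ‖ < s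

/-- `Z` is an M-matrix: `Z = s • I − D` with `s > 0`, `D ≥ 0` entrywise and `ρ(D) ≤ s`. -/
def IsMMatrix {ι : Type*} [Fintype ι] [DecidableEq ι] (Z : Matrix ι ι ℝ) : Prop :=
  ∃ (s : ℝ) (D : Matrix ι ι ℝ),
    0 < s ∧ (∀ i j, 0 ≤ D i j) ∧ Z = s • (1 : Matrix ι ι ℝ) - D ∧ specRadLE D s

/-- `Z` is a nonsingular M-matrix: as above but with `ρ(D) < s`. -/
def IsNonsingMMatrix {ι : Type*} [Fintype ι] [DecidableEq ι] (Z : Matrix ι ι ℝ) : Prop :=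
  ∃ (s : ℝ) (D : Matrix ι ι ℝ),
    0 < s ∧ (∀ i j, 0 ≤ D i j) ∧ Z = s • (1 : Matrix ι ι ℝ) - D ∧ specRadLT D s

open scoped Matrix.Norms.L2Operator MatrixOrder

section SpectrumAndNorm

variable {ι : Type*} [Fintype ι] [DecidableEq ι]

lemma ofReal_mem_spectrum_map_iff (D : Matrix ι ι ℝ) (x : ℝ) :
    (x : ℂ) ∈ spectrum ℂ (D.map (algebraMap ℝ ℂ)) ↔ x ∈ spectrum ℝ D := by
  have h : algebraMap ℂ (Matrix ι ι ℂ) x - D.map (algebraMap ℝ ℂ) =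
      (algebraMap ℝ ℂ).mapMatrix (algebraMap ℝ (Matrix ι ι ℝ) x - D) := by
    ext i j
    by_cases hij : i = j <;> simp [Matrix.algebraMap_matrix_apply, hij]
  rw [spectrum.mem_iff, spectrum.mem_iff, h, Matrix.isUnit_iff_isUnit_det,
    Matrix.isUnit_iff_isUnit_det, ← RingHom.map_det]
  simp

lemma norm_le_of_abs_spectrum_le {D : Matrix ι ι ℝ} (hD : IsSelfAdjoint D) {s : ℝ} (hs : 0 ≤ s)
    (h : ∀ x ∈ spectrum ℝ D, |x| ≤ s) : ‖D‖ ≤ s := by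
  have := norm_cfc_le (f := id) (a := D) hs h
  rwa [cfc_id ℝ D] at this

lemma norm_one_matrix_le : ‖(1 : Matrix ι ι ℝ)‖ ≤ 1 := by
  rw [← Matrix.diagonal_one, Matrix.l2_opNorm_diagonal]
  exact (pi_norm_le_iff_of_nonneg zero_le_one).2 fun i => by simp

lemma norm_submatrix_inl_le {κ : Type*} [Fintype κ] [DecidableEq κ]
    (D : Matrix (ι ⊕ κ) (ι ⊕ κ) ℝ) : ‖D.submatrix Sum.inl Sum.inl‖ ≤ ‖D‖ := by
  set E : Matrix (ι ⊕ κ) ι ℝ := (1 : Matrix (ι ⊕ κ) (ι ⊕ κ) ℝ).submatrix id Sum.inl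
  have hE : ‖E‖ ≤ 1 := by
    have h : Eᴴ * E = 1 := by
      ext i j
      simp [E, Matrix.mul_apply, Matrix.one_apply]
    have h1 := Matrix.l2_opNorm_conjTranspose_mul_self E
    rw [h] at h1
    nlinarith [norm_one_matrix_le (ι := ι), norm_nonneg E]
  have h : D.submatrix Sum.inl Sum.inl = Eᴴ * D * E := by
    ext i j
    simp [E, Matrix.mul_apply, Matrix.one_apply]
  rw [h]
  calc ‖Eᴴ * D * E‖ ≤ ‖Eᴴ‖ * ‖D‖ * ‖E‖ :=
        (Matrix.l2_opNorm_mul _ _).trans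
          (mul_le_mul_of_nonneg_right (Matrix.l2_opNorm_mul _ _) (norm_nonneg _))
    _ ≤ 1 * ‖D‖ * 1 := by
        rw [Matrix.l2_opNorm_conjTranspose]
        gcongr
    _ = ‖D‖ := by ring

/-- If `κ T⁻¹ = α A + κ` with `A` positive semidefinite, then `T` is a contraction. -/
lemma norm_le_one_of_resolvent {A T : Matrix ι ι ℝ} (hA : A.PosSemidef) (hT : Tᵀ = T)
    {α κ : ℝ} (hα : 0 ≤ α) (hκ : 0 < κ) (h : α • (A * T) = κ • (1 - T)) : ‖T‖ ≤ 1 := by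
  have hTs : IsSelfAdjoint T := by
    rwa [IsSelfAdjoint, Matrix.star_eq_conjTranspose, Matrix.conjTranspose_eq_transpose_of_trivial]
  have hpos : 0 ≤ T - T ^ 2 := by
    have h1 : T - T ^ 2 = (κ⁻¹ * α) • (Tᴴ * A * T) := by
      rw [mul_smul, mul_assoc, ← Matrix.mul_smul, h, Matrix.conjTranspose_eq_transpose_of_trivial,
        hT, Matrix.mul_smul, smul_smul, inv_mul_cancel₀ hκ.ne', one_smul, mul_sub, mul_one, sq]
    rw [h1, Matrix.nonneg_iff_posSemidef]
    exact (hA.conjTranspose_mul_mul_same T).smul (by positivity)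
  refine norm_le_of_abs_spectrum_le hTs zero_le_one fun x hx => ?_
  have hmem : x - x ^ 2 ∈ spectrum ℝ (T - T ^ 2) := by
    have := spectrum.subset_polynomial_aeval T (Polynomial.X - Polynomial.X ^ 2 : Polynomial ℝ)
      ⟨x, hx, rfl⟩
    simpa using this
  have := spectrum_nonneg_of_nonneg hpos hmem
  rw [abs_le]
  constructor <;> nlinarith

end SpectrumAndNorm

/-- The limit of an iteration that stays in a closed set lies in that set. -/
lemma mem_of_isClosed_of_contraction {E : Type*} [NormedAddCommGroup E] {s : Set E}
    (hs : IsClosed s) {F : E → E} {x₀ y : E} (hx₀ : x₀ ∈ s) (hF : ∀ x ∈ s, F x ∈ s) {q : ℝ}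
    (hq0 : 0 ≤ q) (hq1 : q < 1) (h : ∀ x ∈ s, ‖F x - y‖ ≤ q * ‖x - y‖) : y ∈ s := by
  have hmem : ∀ k, F^[k] x₀ ∈ s := fun k => by
    induction k with
    | zero => exact hx₀
    | succ k ih => rw [Function.iterate_succ_apply']; exact hF _ ih
  have hbound : ∀ k, ‖F^[k] x₀ - y‖ ≤ q ^ k * ‖x₀ - y‖ := fun k => by
    induction k with
    | zero => simp
    | succ k ih =>
      rw [Function.iterate_succ_apply', pow_succ', mul_assoc]
      exact (h _ (hmem k)).trans (mul_le_mul_of_nonneg_left ih hq0)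
  refine hs.mem_of_tendsto (f := fun k => F^[k] x₀) (b := Filter.atTop) ?_
    (Filter.Eventually.of_forall hmem)
  rw [tendsto_iff_norm_sub_tendsto_zero]
  refine squeeze_zero (fun _ => norm_nonneg _) hbound ?_
  simpa using (tendsto_pow_atTop_nhds_zero_of_lt_one hq0 hq1).mul_const ‖x₀ - y‖

section Entrywise

lemma isClosed_setOf_entrywise_nonneg {ι κ : Type*} :
    IsClosed {X : Matrix ι κ ℝ | ∀ i j, 0 ≤ X i j} := by
  simp only [Set.ofPred_forall]
  exact isClosed_iInter fun i => isClosed_iInter fun j =>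
    isClosed_le continuous_const (by fun_prop)

lemma mul_entrywise_nonneg {ι κ l : Type*} [Fintype l] {X : Matrix ι l ℝ} {Y : Matrix l κ ℝ}
    (hX : ∀ i j, 0 ≤ X i j) (hY : ∀ i j, 0 ≤ Y i j) (i : ι) (j : κ) : 0 ≤ (X * Y) i j :=
  Finset.sum_nonneg fun k _ => mul_nonneg (hX i k) (hY k j)

variable {ι : Type*} [Fintype ι] [DecidableEq ι]

/-- The contractive solution of a quadratic matrix equation with nonnegative coefficients
is entrywise nonnegative. -/
lemma entrywise_nonneg_of_quadratic_fixed_point {N T : Matrix ι ι ℝ} {α c : ℝ}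
    (hα0 : 0 ≤ α) (hα1 : α < 1) (hN : ∀ i j, 0 ≤ N i j) (hNc : ‖N‖ ≤ c) (hT : ‖T‖ ≤ 1)
    (h : (1 + α + c) • T = 1 + N * T + α • (T * T)) (i j : ι) : 0 ≤ T i j := by
  have hc : 0 ≤ c := (norm_nonneg N).trans hNc
  have hd : 0 < 1 + α + c := by linarith
  set d := 1 + α + c
  have hTd : T = d⁻¹ • (1 + N * T + α • (T * T)) := by
    rw [← h, smul_smul, inv_mul_cancel₀ hd.ne', one_smul]
  suffices T ∈ {X : Matrix ι ι ℝ | ∀ i j, 0 ≤ X i j} ∩ Metric.closedBall 0 1 from this.1 i j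
  refine mem_of_isClosed_of_contraction (x₀ := 0) (q := d⁻¹ * (c + 2 * α))
    (F := fun X => d⁻¹ • (1 + N * X + α • (X * X)))
    (isClosed_setOf_entrywise_nonneg.inter Metric.isClosed_closedBall) (by simp) ?_
    (by positivity) ?_ ?_
  · rintro X ⟨hX, hX1⟩
    rw [mem_closedBall_zero_iff] at hX1
    refine ⟨fun i j => ?_, ?_⟩
    · have h1 : 0 ≤ (1 : Matrix ι ι ℝ) i j := by
        rw [Matrix.one_apply]; split_ifs <;> norm_num
      have h2 := mul_entrywise_nonneg hN hX i j
      have h3 := mul_entrywise_nonneg hX hX i j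
      simp only [Matrix.smul_apply, Matrix.add_apply, smul_eq_mul]
      positivity
    · rw [mem_closedBall_zero_iff, norm_smul, Real.norm_of_nonneg (by positivity)]
      have h1 : ‖N * X‖ ≤ c * 1 := (norm_mul_le _ _).trans (by gcongr)
      have h2 : ‖α • (X * X)‖ ≤ α * (1 * 1) := by
        rw [norm_smul, Real.norm_of_nonneg hα0]
        gcongr
        exact (norm_mul_le _ _).trans (by gcongr)
      have h3 := norm_add₃_le (a := 1) (b := N * X) (c := α • (X * X))
      rw [inv_mul_le_iff₀ hd]
      linarith [norm_one_matrix_le (ι := ι)]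
  · rw [inv_mul_lt_iff₀ hd]
    linarith
  · rintro X ⟨-, hX1⟩
    rw [mem_closedBall_zero_iff] at hX1
    have hdiff : d⁻¹ • (1 + N * X + α • (X * X)) - T =
        d⁻¹ • (N * (X - T) + α • (X * (X - T) + (X - T) * T)) := by
      conv_lhs => rw [hTd]
      rw [← smul_sub, mul_sub, mul_sub, sub_mul]
      congr 1
      simp only [smul_add, smul_sub]
      abel
    simp only [hdiff]
    rw [norm_smul, Real.norm_of_nonneg (by positivity), mul_assoc]
    gcongr
    have h1 : ‖N * (X - T)‖ ≤ c * ‖X - T‖ := (norm_mul_le _ _).trans (by gcongr)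
    have h2 : ‖X * (X - T)‖ ≤ 1 * ‖X - T‖ := (norm_mul_le _ _).trans (by gcongr)
    have h3 : ‖(X - T) * T‖ ≤ ‖X - T‖ * 1 := (norm_mul_le _ _).trans (by gcongr)
    have h4 : ‖α • (X * (X - T) + (X - T) * T)‖ ≤ α * (2 * ‖X - T‖) := by
      rw [norm_smul, Real.norm_of_nonneg hα0]
      gcongr
      linarith [norm_add_le (X * (X - T)) ((X - T) * T)]
    linarith [norm_add_le (N * (X - T)) (α • (X * (X - T) + (X - T) * T))]

lemma entrywise_nonneg_of_affine_fixed_point {κ : Type*} [Fintype κ] [DecidableEq κ]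
    {E : Matrix ι ι ℝ} {P X : Matrix ι κ ℝ}
    (hE : ∀ i j, 0 ≤ E i j) (hE1 : ‖E‖ < 1) (hP : ∀ i j, 0 ≤ P i j) (h : X = P + E * X)
    (i : ι) (j : κ) : 0 ≤ X i j := by
  suffices X ∈ {X : Matrix ι κ ℝ | ∀ i j, 0 ≤ X i j} from this i j
  refine mem_of_isClosed_of_contraction (x₀ := 0) (q := ‖E‖) (F := fun Y => P + E * Y)
    isClosed_setOf_entrywise_nonneg (by simp) (fun Y hY i j => ?_) (norm_nonneg _) hE1
    fun Y _ => ?_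
  · exact add_nonneg (hP i j) (mul_entrywise_nonneg hE hY i j)
  · have : P + E * Y - X = E * (Y - X) := by
      conv_lhs => rw [h]
      rw [Matrix.mul_sub]
      abel
    simp only [this]
    exact Matrix.l2_opNorm_mul _ _

/-- A positive definite matrix with nonpositive off-diagonal entries is a nonsingular M-matrix. -/
lemma isNonsingMMatrix_of_posDef {K : Matrix ι ι ℝ} (hK : K.PosDef)
    (hoff : ∀ i j, i ≠ j → K i j ≤ 0) : IsNonsingMMatrix K := by
  have hdiag : ∀ i, 0 < K i i := fun i => hK.diag_pos
  have hsum : 0 ≤ ∑ i, K i i := Finset.sum_nonneg fun i _ => (hdiag i).le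
  set s : ℝ := 1 + ‖K‖ + ∑ i, K i i
  have hnorm := norm_nonneg K
  refine ⟨s, s • 1 - K, by positivity, fun i j => ?_, by abel, fun μ hμ => ?_⟩
  · by_cases hij : i = j
    · subst hij
      have := Finset.single_le_sum (f := fun i => K i i) (fun i _ => (hdiag i).le)
        (Finset.mem_univ i)
      simp only [Matrix.sub_apply, Matrix.smul_apply, Matrix.one_apply_eq, smul_eq_mul] at *
      linarith
    · simpa [hij] using hoff i j hij
  · have hsa : IsSelfAdjoint ((s • 1 - K).map (algebraMap ℝ ℂ)) := by
      rw [IsSelfAdjoint, Matrix.star_eq_conjTranspose]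
      ext i j
      have := congrFun (congrFun hK.isHermitian i) j
      simp only [Matrix.conjTranspose_apply, star_trivial] at this
      simp [Matrix.one_apply, this, eq_comm]
    have hre := hsa.mem_spectrum_eq_re hμ
    rw [hre, ofReal_mem_spectrum_map_iff] at hμ
    have hmem : s - μ.re ∈ spectrum ℝ K := by
      rw [spectrum.mem_iff] at hμ ⊢
      rw [← IsUnit.neg_iff]
      convert hμ using 2
      simp only [map_sub, Algebra.algebraMap_eq_smul_one]
      abel
    have hpos : 0 < s - μ.re :=
      (Matrix.isStrictlyPositive_iff_posDef.2 hK).spectrum_pos hmem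
    have hle : |s - μ.re| ≤ ‖K‖ := by
      have : Nonempty ι := by
        by_contra hne
        rw [not_nonempty_iff] at hne
        exact hmem (isUnit_of_subsingleton _)
      have := spectrum.norm_le_norm_mul_of_mem hmem
      exact this.trans (mul_le_of_le_one_right hnorm norm_one_matrix_le)
    rw [hre, Complex.norm_real, Real.norm_eq_abs, abs_lt]
    rw [abs_le] at hle
    constructor <;> linarith

end Entrywise

lemma mul_Bmat {n m : ℕ} {ι : Type*} (K : Matrix ι (Fin n ⊕ Fin m) ℝ) :
    K * Bmat n m = K.submatrix id Sum.inl := by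
  ext i j
  simp [Bmat, Matrix.mul_apply, Fintype.sum_sum_type]

lemma Bmat_transpose_mul {n m : ℕ} {ι : Type*} (K : Matrix (Fin n ⊕ Fin m) ι ℝ) :
    (Bmat n m)ᵀ * K = K.submatrix Sum.inl id := by
  ext i j
  simp [Bmat, Matrix.mul_apply, Fintype.sum_sum_type]

theorem riccati_solution_is_M_matrix
    (n m : ℕ) (hn : 0 < n) (hm : 0 < m)
    (α : ℝ) (hα : α ∈ Set.Ioo (0 : ℝ) 1) (κM : ℝ) (hκM : 0 < κM)
    (Q K : Matrix (Fin n ⊕ Fin m) (Fin n ⊕ Fin m) ℝ)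
    (hQsymm : Qᵀ = Q) (hQM : IsMMatrix Q)
    (hKsymm : Kᵀ = K) (hKpd : K.PosDef)
    (hRic : K = α • K -
      α ^ 2 • (K * Bmat n m *
        (α • ((Bmat n m)ᵀ * K * Bmat n m) + κM • (1 : Matrix (Fin n) (Fin n) ℝ))⁻¹ *
        (Bmat n m)ᵀ * K) + Q) :
    (∀ i j, i ≠ j → K i j ≤ 0) ∧ IsNonsingMMatrix K := by
  obtain ⟨hα0, hα1⟩ := hα
  obtain ⟨s, D, hs, hD, hQD, hρ⟩ := hQM
  suffices hoff : ∀ i j, i ≠ j → K i j ≤ 0 from ⟨hoff, isNonsingMMatrix_of_posDef hKpd hoff⟩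
  have hQoff : ∀ i j, i ≠ j → Q i j ≤ 0 := fun i j hij => by
    simp [hQD, hij, hD i j]
  set A := K.submatrix (Sum.inl : Fin n → Fin n ⊕ Fin m) Sum.inl with hA
  have hApd : A.PosDef := hKpd.submatrix Sum.inl_injective
  set S := α • A + κM • (1 : Matrix (Fin n) (Fin n) ℝ) with hS
  have hSpd : S.PosDef := (hApd.smul hα0).add (Matrix.PosDef.one.smul hκM)
  have hSdet : IsUnit S.det := (Matrix.isUnit_iff_isUnit_det _).1 hSpd.isUnit
  set T := κM • S⁻¹ with hT
  have hTsymm : Tᵀ = T := by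
    have : Sᵀ = S := by
      rw [← Matrix.conjTranspose_eq_transpose_of_trivial]; exact hSpd.isHermitian
    rw [hT, Matrix.transpose_smul, Matrix.transpose_nonsing_inv, this]
  have hAT : α • (A * T) = κM • (1 - T) := by
    have h : S * T = κM • 1 := by rw [hT, Matrix.mul_smul, Matrix.mul_nonsing_inv _ hSdet]
    rw [hS, Matrix.add_mul, Matrix.smul_mul, Matrix.smul_mul, Matrix.one_mul] at h
    rw [smul_sub, ← h, add_sub_cancel_right]
  have hT1 : ‖T‖ ≤ 1 := norm_le_one_of_resolvent hApd.posSemidef hTsymm hα0.le hκM hAT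
  have hSinv : S⁻¹ = κM⁻¹ • T := by rw [hT, smul_smul, inv_mul_cancel₀ hκM.ne', one_smul]
  have hBKB : (Bmat n m)ᵀ * K * Bmat n m = A := by
    rw [Bmat_transpose_mul, mul_Bmat, Matrix.submatrix_submatrix]; rfl
  rw [hBKB, ← hS, Matrix.mul_assoc _ (Bmat n m)ᵀ K, mul_Bmat, Bmat_transpose_mul, hSinv] at hRic
  have hblock : ∀ {p q : ℕ} (f : Fin p → Fin n ⊕ Fin m) (g : Fin q → Fin n ⊕ Fin m),
      K.submatrix f g = α • K.submatrix f g - (α ^ 2 * κM⁻¹) •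
        (K.submatrix f Sum.inl * T * K.submatrix Sum.inl g) + Q.submatrix f g := by
    intro p q f g
    conv_lhs => rw [hRic]
    ext i j
    simp [Matrix.mul_apply, mul_assoc]
  have htop : ∀ {q : ℕ} (g : Fin q → Fin n ⊕ Fin m),
      K.submatrix Sum.inl g = Q.submatrix Sum.inl g + α • (T * K.submatrix Sum.inl g) := by
    intro q g
    have h := hblock Sum.inl g
    have h1 : (α ^ 2 * κM⁻¹) • (A * T * K.submatrix Sum.inl g) =
        α • (K.submatrix Sum.inl g - T * K.submatrix Sum.inl g) := by
      rw [show α ^ 2 * κM⁻¹ = α * κM⁻¹ * α by ring, mul_smul, ← Matrix.smul_mul, hAT,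
        Matrix.smul_mul, smul_smul, mul_assoc, inv_mul_cancel₀ hκM.ne', mul_one, Matrix.sub_mul,
        Matrix.one_mul]
    rw [← hA, h1, smul_sub] at h
    conv_lhs => rw [h]
    abel
  set D₁ := D.submatrix (Sum.inl : Fin n → Fin n ⊕ Fin m) Sum.inl
  have hQ₁ : Q.submatrix (Sum.inl : Fin n → Fin n ⊕ Fin m) Sum.inl = s • 1 - D₁ := by
    rw [hQD]
    ext i j
    simp [D₁, Matrix.one_apply]
  have hTA : α • (T * A) = κM • (1 - T) := by
    have h := congrArg Matrix.transpose hAT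
    have hAsymm : Aᵀ = A := by
      rw [← Matrix.conjTranspose_eq_transpose_of_trivial]; exact hApd.isHermitian
    simpa [Matrix.transpose_mul, hTsymm, hAsymm] using h
  have hAeq : A = s • 1 - D₁ + κM • (1 - T) := by
    have h := htop (Sum.inl : Fin n → Fin n ⊕ Fin m)
    rwa [← hA, hQ₁, hTA] at h
  have hDnorm : ‖D‖ ≤ s := by
    have hDsa : IsSelfAdjoint D := by
      have h : D = s • 1 - Q := by rw [hQD]; abel
      rw [IsSelfAdjoint, Matrix.star_eq_conjTranspose,
        Matrix.conjTranspose_eq_transpose_of_trivial, h]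
      simp [hQsymm]
    refine norm_le_of_abs_spectrum_le hDsa hs.le fun x hx => ?_
    simpa using hρ x ((ofReal_mem_spectrum_map_iff D x).2 hx)
  have hT0 : ∀ i j, 0 ≤ T i j := by
    refine entrywise_nonneg_of_quadratic_fixed_point (N := (α * κM⁻¹) • D₁) (c := α * κM⁻¹ * s)
      hα0.le hα1 (fun i j => ?_) ?_ hT1 ?_
    · exact mul_nonneg (by positivity) (hD _ _)
    · rw [norm_smul, Real.norm_of_nonneg (by positivity)]
      exact mul_le_mul_of_nonneg_left ((norm_submatrix_inl_le D).trans hDnorm) (by positivity)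
    · have h := hAT
      rw [hAeq] at h
      ext i j
      have hij := congrFun (congrFun h i) j
      simp only [Matrix.add_mul, Matrix.sub_mul, Matrix.smul_mul, Matrix.one_mul, smul_sub,
        Matrix.add_apply, Matrix.sub_apply, Matrix.smul_apply, smul_eq_mul] at hij ⊢
      field_simp
      linarith
  have hC0 : ∀ i j, K (Sum.inl i) (Sum.inr j) ≤ 0 := by
    intro i j
    have h := entrywise_nonneg_of_affine_fixed_point (E := α • T)
      (P := -Q.submatrix (Sum.inl : Fin n → Fin n ⊕ Fin m) Sum.inr)
      (X := -K.submatrix (Sum.inl : Fin n → Fin n ⊕ Fin m) Sum.inr)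
      (fun i j => mul_nonneg hα0.le (hT0 i j)) ?_
      (fun i j => neg_nonneg.2 (hQoff _ _ Sum.inl_ne_inr)) ?_ i j
    · simpa using h
    · rw [norm_smul, Real.norm_of_nonneg hα0.le]
      nlinarith
    · conv_lhs => rw [htop]
      rw [Matrix.mul_neg, Matrix.smul_mul α T, neg_add]
  have hKs : ∀ i j, K i j = K j i := fun i j => congrFun (congrFun hKsymm j) i
  rintro (i | i) (j | j) hij
  · have h := congrFun (congrFun hAeq i) j
    have hne : i ≠ j := fun e => hij (congrArg _ e)
    have hDij : 0 ≤ D₁ i j := hD _ _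
    simp only [hA, Matrix.submatrix_apply, Matrix.add_apply, Matrix.sub_apply, Matrix.smul_apply,
      Matrix.one_apply_ne hne, smul_eq_mul] at h
    nlinarith [mul_nonneg hκM.le (hT0 i j)]
  · exact hC0 i j
  · rw [hKs]; exact hC0 j i
  · have h := congrFun (congrFun (hblock (Sum.inr : Fin m → Fin n ⊕ Fin m) Sum.inr) i) j
    have hpos : 0 ≤ (K.submatrix Sum.inr Sum.inl * T * K.submatrix Sum.inl Sum.inr :
        Matrix (Fin m) (Fin m) ℝ) i j := by
      simp only [Matrix.mul_apply, Matrix.submatrix_apply]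
      refine Finset.sum_nonneg fun k _ => mul_nonneg_of_nonpos_of_nonpos ?_ (hC0 k j)
      refine Finset.sum_nonpos fun l _ => mul_nonpos_of_nonpos_of_nonneg ?_ (hT0 l k)
      rw [hKs]
      exact hC0 l i
    simp only [Matrix.submatrix_apply, Matrix.add_apply, Matrix.sub_apply, Matrix.smul_apply,
      smul_eq_mul] at h
    have h1 : 0 ≤ (α ^ 2 * κM⁻¹) * (K.submatrix Sum.inr Sum.inl * T * K.submatrix Sum.inl Sum.inr :
        Matrix (Fin m) (Fin m) ℝ) i j := mul_nonneg (by positivity) hpos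
    nlinarith [hQoff _ _ hij]
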